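/- Lower bound on the successful set in the correlated-pair regime (Lemma 5.2): Fix an integer k ≥ 1 and η ∈ (0,1). There exist a constant C > 0 and an integer n₀ (depending only on k and η) such that for all n ≥ n₀ the following holds: for every homogeneous degree-k objective H on {-1,1}^n that is not identically zero and every optimum assignment x* of H, the successful set S_η^ns = {x*⊙t : t ∈ A_η and H(x*⊙t) ≤ (1-η)·H_min} satisfies |S_η^ns| ≥ (1/(2n))·2^{h(q_η)·n - C·n^{2/3}}. -/

import Mathlib

open scoped Classical

noncomputable section

/-- The sign value of a Boolean coordinate: `true` encodes `-1`, `false` encodes `1`. -/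
def sgn (b : Bool) : ℝ := if b then -1 else 1

/-- The number of `-1` coordinates (i.e. `true` coordinates) of a point of the cube. -/
def wt {n : ℕ} (t : Fin n → Bool) : ℕ := (Finset.univ.filter fun i => t i = true).card

/-- The binary entropy function `h(t) = -t·log₂ t - (1-t)·log₂(1-t)`. -/
def binEnt (t : ℝ) : ℝ := -t * Real.logb 2 t - (1 - t) * Real.logb 2 (1 - t)

/-- The limiting flip rate `q_η = (1 - (1-η)^{1/k})/2`. -/
def qlim (k : ℕ) (η : ℝ) : ℝ := (1 - (1 - η) ^ ((1 : ℝ) / k)) / 2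

/-- The finite-`n` flip rate `q_{η,n} = (1 - (1-η+η/n)^{1/k})/2`. -/
def qfin (k n : ℕ) (η : ℝ) : ℝ := (1 - (1 - η + η / n) ^ ((1 : ℝ) / k)) / 2

/-- The typical shell `A_η = {t ∈ {-1,1}^n : |wt(t) - q_{η,n}·n| ≤ n^{2/3}}`. -/
def shell (k n : ℕ) (η : ℝ) : Finset (Fin n → Bool) :=
  Finset.univ.filter fun t => |(wt t : ℝ) - qfin k n η * n| ≤ (n : ℝ) ^ ((2 : ℝ) / 3)

end

noncomputable section

/-- A homogeneous degree-`k` objective `H(x) = ∑_{S ∈ 𝓕} c_S ∏_{i ∈ S} x_i` on `{-1,1}^n`,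
with the cube encoded as `Fin n → Bool` via `sgn`. -/
def objH {n : ℕ} (F : Finset (Finset (Fin n))) (c : Finset (Fin n) → ℝ)
    (x : Fin n → Bool) : ℝ :=
  ∑ S ∈ F, c S * ∏ i ∈ S, sgn (x i)

/-- The successful set `S_η^{ns} = {x*⊙t : t ∈ A_η, H(x*⊙t) ≤ (1-η)·H_min}` of the
correlated-pair regime, where `⊙` is coordinatewise multiplication (`xor` on the Boolean
encoding) and `H_min = H(x*)`. -/
def succSetNS {n : ℕ} (k : ℕ) (η : ℝ) (F : Finset (Finset (Fin n)))
    (c : Finset (Fin n) → ℝ) (xstar : Fin n → Bool) : Finset (Fin n → Bool) :=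
  ((shell k n η).filter fun t =>
      objH F c (fun i => xor (xstar i) (t i)) ≤ (1 - η) * objH F c xstar).image
    fun t => fun i => xor (xstar i) (t i)

end

section ProductMeasure

/-- The probability of `t` when each coordinate is independently `true` with probability `q`. -/
noncomputable def bernoulliWeight {n : ℕ} (q : ℝ) (t : Fin n → Bool) : ℝ :=
  ∏ i, (if t i then q else 1 - q)

variable {n : ℕ}

lemma sum_cube_prod (f : Fin n → Bool → ℝ) :
    ∑ t : Fin n → Bool, ∏ i, f i (t i) = ∏ i, (f i true + f i false) := by
  have h := Finset.prod_univ_sum (fun _ : Fin n => (Finset.univ : Finset Bool)) f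
  rw [Fintype.piFinset_univ] at h
  rw [← h]
  simp

lemma bernoulliWeight_nonneg {q : ℝ} (h0 : 0 ≤ q) (h1 : q ≤ 1) (t : Fin n → Bool) :
    0 ≤ bernoulliWeight q t := by
  refine Finset.prod_nonneg fun i _ => ?_
  split_ifs <;> linarith

lemma bernoulliWeight_pos {q : ℝ} (h0 : 0 < q) (h1 : q < 1) (t : Fin n → Bool) :
    0 < bernoulliWeight q t := by
  refine Finset.prod_pos fun i _ => ?_
  split_ifs <;> linarith

lemma sum_bernoulliWeight (q : ℝ) : ∑ t : Fin n → Bool, bernoulliWeight q t = 1 := by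
  have h := sum_cube_prod (n := n) fun _ b => if b then q else 1 - q
  simpa [bernoulliWeight] using h

lemma wt_eq_sum (t : Fin n → Bool) : (wt t : ℝ) = ∑ i, if t i then (1 : ℝ) else 0 := by
  simp [wt]

lemma bernoulliWeight_eq_exp {q : ℝ} (h0 : 0 < q) (h1 : q < 1) (t : Fin n → Bool) :
    bernoulliWeight q t =
      Real.exp (wt t * Real.log q + (n - wt t) * Real.log (1 - q)) := by
  have h : (wt t : ℝ) * Real.log q + (n - wt t) * Real.log (1 - q) =
      ∑ i, if t i then Real.log q else Real.log (1 - q) := by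
    have hi : ∀ i, (if t i then Real.log q else Real.log (1 - q)) =
        (if t i then (1 : ℝ) else 0) * (Real.log q - Real.log (1 - q)) + Real.log (1 - q) := by
      intro i
      split_ifs <;> ring
    simp_rw [hi]
    rw [Finset.sum_add_distrib, ← Finset.sum_mul, ← wt_eq_sum]
    simp
    ring
  rw [h, Real.exp_sum, bernoulliWeight]
  refine Finset.prod_congr rfl fun i _ => ?_
  split_ifs
  · rw [Real.exp_log h0]
  · rw [Real.exp_log (by linarith)]

lemma sgn_xor (a b : Bool) : sgn (xor a b) = sgn a * sgn b := by
  cases a <;> cases b <;> simp [sgn]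

lemma sum_bernoulliWeight_mul_prod_sgn (q : ℝ) (S : Finset (Fin n)) :
    ∑ t : Fin n → Bool, bernoulliWeight q t * ∏ i ∈ S, sgn (t i) = (1 - 2 * q) ^ S.card := by
  have h := sum_cube_prod fun (i : Fin n) b =>
    (if b then q else 1 - q) * (if i ∈ S then sgn b else 1)
  have e : ∀ i : Fin n, ((if true then q else 1 - q) * (if i ∈ S then sgn true else 1) +
      (if false then q else 1 - q) * (if i ∈ S then sgn false else 1)) =
      if i ∈ S then 1 - 2 * q else 1 := by
    intro i
    split_ifs <;> simp_all [sgn]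
    ring
  rw [Finset.prod_congr rfl fun i _ => e i] at h
  simp only [Finset.prod_mul_distrib] at h
  simpa [bernoulliWeight, Finset.prod_ite_mem] using h

lemma sum_bernoulliWeight_mul_objH {k : ℕ} (q : ℝ) {F : Finset (Finset (Fin n))}
    (c : Finset (Fin n) → ℝ) (hF : ∀ S ∈ F, S.card = k) (x : Fin n → Bool) :
    ∑ t : Fin n → Bool, bernoulliWeight q t * objH F c (fun i => xor (x i) (t i)) =
      (1 - 2 * q) ^ k * objH F c x := by
  simp only [objH, sgn_xor, Finset.prod_mul_distrib, Finset.mul_sum]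
  rw [Finset.sum_comm]
  refine Finset.sum_congr rfl fun S hS => ?_
  rw [← hF S hS, ← sum_bernoulliWeight_mul_prod_sgn, Finset.sum_mul]
  exact Finset.sum_congr rfl fun t _ => by ring

lemma objH_min_neg {k : ℕ} (hk : 1 ≤ k) {F : Finset (Finset (Fin n))}
    {c : Finset (Fin n) → ℝ} (hF : ∀ S ∈ F, S.card = k) (hne : ∃ x, objH F c x ≠ 0)
    {x : Fin n → Bool} (hx : ∀ y, objH F c x ≤ objH F c y) : objH F c x < 0 := by
  by_contra! h0
  obtain ⟨y, hy⟩ := hne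
  have hs := sum_bernoulliWeight_mul_objH (1 / 2) c hF x
  rw [show (1 - 2 * (1 / 2 : ℝ)) = 0 by norm_num, zero_pow (by lia), zero_mul] at hs
  rw [Finset.sum_eq_zero_iff_of_nonneg] at hs
  · have hz := hs (fun i => xor (x i) (y i)) (Finset.mem_univ _)
    have hw := bernoulliWeight_pos (q := 1 / 2) (by norm_num) (by norm_num)
      fun i => xor (x i) (y i)
    have hz' := (mul_eq_zero.mp hz).resolve_left hw.ne'
    simp at hz'
    exact hy hz'
  · intro t _
    exact mul_nonneg (bernoulliWeight_nonneg (by norm_num) (by norm_num) t) (h0.trans (hx _))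

/-- A reverse Markov inequality for the objective at a correlated copy of its minimizer. -/
lemma le_sum_bernoulliWeight_good {k : ℕ} {q η δ : ℝ} (h0 : 0 ≤ q) (h1 : q ≤ 1) (hη : 0 < η)
    (hq : (1 - 2 * q) ^ k = 1 - η + η * δ) {F : Finset (Finset (Fin n))}
    {c : Finset (Fin n) → ℝ} (hF : ∀ S ∈ F, S.card = k)
    {x : Fin n → Bool} (hx : ∀ y, objH F c x ≤ objH F c y) (hneg : objH F c x < 0) :
    δ ≤ ∑ t : Fin n → Bool with
      objH F c (fun i => xor (x i) (t i)) ≤ (1 - η) * objH F c x, bernoulliWeight q t := by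
  have hs := sum_bernoulliWeight_mul_objH q c hF x
  rw [hq] at hs
  rw [Finset.sum_filter]
  set G : ℝ := ∑ t : Fin n → Bool, if objH F c (fun i => xor (x i) (t i)) ≤
    (1 - η) * objH F c x then bernoulliWeight q t else 0 with hG
  have hle : (1 - η) * objH F c x + η * objH F c x * G ≤ (1 - η + η * δ) * objH F c x := by
    calc (1 - η) * objH F c x + η * objH F c x * G
        = ∑ t : Fin n → Bool, (bernoulliWeight q t * ((1 - η) * objH F c x) +
            η * objH F c x * if objH F c (fun i => xor (x i) (t i)) ≤
              (1 - η) * objH F c x then bernoulliWeight q t else 0) := by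
          rw [Finset.sum_add_distrib, ← Finset.sum_mul, ← Finset.mul_sum,
            sum_bernoulliWeight, one_mul]
      _ ≤ ∑ t : Fin n → Bool, bernoulliWeight q t * objH F c (fun i => xor (x i) (t i)) := by
          refine Finset.sum_le_sum fun t _ => ?_
          have hw := bernoulliWeight_nonneg h0 h1 t
          split_ifs with hgood
          · nlinarith [mul_le_mul_of_nonneg_left (hx fun i => xor (x i) (t i)) hw]
          · rw [mul_zero, add_zero]
            exact mul_le_mul_of_nonneg_left (not_le.mp hgood).le hw
      _ = _ := hs
  have hp : 0 < η * -objH F c x := by nlinarith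
  nlinarith

lemma exp_le_one_add_add_sq {x : ℝ} (hx : |x| ≤ 1) : Real.exp x ≤ 1 + x + x ^ 2 := by
  have := Real.abs_exp_sub_one_sub_id_le hx
  have := (abs_le.mp this).2
  linarith

lemma sum_bernoulliWeight_mul_exp_le {q s : ℝ} (h0 : 0 ≤ q) (h1 : q ≤ 1) (hs : |s| ≤ 1) :
    ∑ t : Fin n → Bool, bernoulliWeight q t * Real.exp (s * (wt t - q * n)) ≤
      Real.exp (s ^ 2 * n) := by
  have h := sum_cube_prod fun (_ : Fin n) b =>
    (if b then q else 1 - q) * Real.exp (s * ((if b then 1 else 0) - q))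
  have e : ∀ t : Fin n → Bool, ∏ i, ((if t i then q else 1 - q) *
      Real.exp (s * ((if t i then 1 else 0) - q))) =
      bernoulliWeight q t * Real.exp (s * (wt t - q * n)) := by
    intro t
    rw [Finset.prod_mul_distrib, ← Real.exp_sum, ← Finset.mul_sum, Finset.sum_sub_distrib,
      ← wt_eq_sum, bernoulliWeight]
    simp [mul_comm]
  simp only [e] at h
  rw [h, Finset.prod_const, Finset.card_univ, Fintype.card_fin, mul_comm (s ^ 2), Real.exp_nat_mul]
  simp only [if_true, Bool.false_eq_true, if_false]
  have hs' := abs_le.mp hs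
  have hb : ∀ a : ℝ, |a| ≤ 1 → Real.exp (s * a) ≤ 1 + s * a + (s * a) ^ 2 := fun a ha =>
    exp_le_one_add_add_sq (by rw [abs_mul]; exact mul_le_one₀ hs (abs_nonneg _) ha)
  have ht := hb (1 - q) (by rw [abs_le]; constructor <;> linarith)
  have hf := hb (0 - q) (by rw [abs_le]; constructor <;> linarith)
  refine pow_le_pow_left₀ (add_nonneg (mul_nonneg h0 (Real.exp_pos _).le)
    (mul_nonneg (sub_nonneg.mpr h1) (Real.exp_pos _).le)) ?_ n
  have hvar : q * (1 - q) ≤ 1 := by nlinarith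
  calc q * Real.exp (s * (1 - q)) + (1 - q) * Real.exp (s * (0 - q))
      ≤ q * (1 + s * (1 - q) + (s * (1 - q)) ^ 2) +
        (1 - q) * (1 + s * (0 - q) + (s * (0 - q)) ^ 2) :=
        add_le_add (mul_le_mul_of_nonneg_left ht h0)
          (mul_le_mul_of_nonneg_left hf (sub_nonneg.mpr h1))
    _ = s ^ 2 * (q * (1 - q)) + 1 := by ring
    _ ≤ s ^ 2 + 1 := by nlinarith [sq_nonneg s]
    _ ≤ Real.exp (s ^ 2) := Real.add_one_le_exp _

lemma sum_bernoulliWeight_tail_le {q s d : ℝ} (h0 : 0 ≤ q) (h1 : q ≤ 1) (hs0 : 0 ≤ s)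
    (hs : s ≤ 1) :
    ∑ t : Fin n → Bool with ¬ |(wt t : ℝ) - q * n| ≤ d, bernoulliWeight q t ≤
      2 * Real.exp (s ^ 2 * n - s * d) := by
  have hp := sum_bernoulliWeight_mul_exp_le (n := n) h0 h1 (abs_le.mpr ⟨by linarith, hs⟩)
  have hm := sum_bernoulliWeight_mul_exp_le (n := n) (s := -s) h0 h1
    (abs_le.mpr ⟨by linarith, by linarith⟩)
  rw [neg_sq] at hm
  have hpt : ∀ t : Fin n → Bool, (if ¬ |(wt t : ℝ) - q * n| ≤ d then bernoulliWeight q t else 0)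
      ≤ (bernoulliWeight q t * Real.exp (s * (wt t - q * n)) +
        bernoulliWeight q t * Real.exp (-s * (wt t - q * n))) * Real.exp (-(s * d)) := by
    intro t
    have hw := bernoulliWeight_nonneg h0 h1 t
    split_ifs with hd
    · positivity
    · rw [← mul_add, mul_assoc, add_mul, ← Real.exp_add, ← Real.exp_add]
      refine le_mul_of_one_le_right hw ?_
      rcases lt_abs.mp (not_le.mp hd) with h | h
      · have := Real.one_le_exp (x := s * (wt t - q * n) + -(s * d)) (by nlinarith)
        linarith [Real.exp_pos (-s * (wt t - q * n) + -(s * d))]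
      · have := Real.one_le_exp (x := -s * (wt t - q * n) + -(s * d)) (by nlinarith)
        linarith [Real.exp_pos (s * (wt t - q * n) + -(s * d))]
  rw [Finset.sum_filter]
  refine (Finset.sum_le_sum fun t _ => hpt t).trans ?_
  rw [← Finset.sum_mul, Finset.sum_add_distrib, sub_eq_add_neg, Real.exp_add, ← mul_assoc]
  exact mul_le_mul_of_nonneg_right (by linarith) (Real.exp_pos _).le

end ProductMeasure

section FlipRate

lemma one_sub_two_mul_qfin_pow {k : ℕ} (hk : 1 ≤ k) (n : ℕ) {η : ℝ} (hη0 : 0 < η)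
    (hη1 : η < 1) : (1 - 2 * qfin k n η) ^ k = 1 - η + η * (1 / n) := by
  have hy : 0 ≤ 1 - η + η / n := by
    have : 0 ≤ η / n := by positivity
    linarith
  rw [show 1 - 2 * qfin k n η = (1 - η + η / n) ^ ((k : ℝ)⁻¹) by rw [qfin, one_div]; ring,
    Real.rpow_inv_natCast_pow hy (by lia)]
  ring

lemma qfin_pos {k n : ℕ} (hk : 1 ≤ k) (hn : 2 ≤ n) {η : ℝ} (hη0 : 0 < η) (hη1 : η < 1) :
    0 < qfin k n η := by
  have hn' : (2 : ℝ) ≤ n := by exact_mod_cast hn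
  have hk' : (0 : ℝ) < k := by exact_mod_cast hk
  have hd : η / n < η := div_lt_self hη0 (by linarith)
  have hd0 : 0 < η / n := by positivity
  have := Real.rpow_lt_one (x := 1 - η + η / n) (z := (1 : ℝ) / k) (by linarith) (by linarith)
    (by positivity)
  rw [qfin]
  linarith

lemma qfin_lt_half (k n : ℕ) {η : ℝ} (hη0 : 0 < η) (hη1 : η < 1) : qfin k n η < 1 / 2 := by
  have : 0 ≤ η / n := by positivity
  have := Real.rpow_pos_of_pos (x := 1 - η + η / n) (by linarith) ((1 : ℝ) / k)
  rw [qfin]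
  linarith

lemma qfin_mono (k : ℕ) {m n : ℕ} (hm : 1 ≤ m) (hmn : m ≤ n) {η : ℝ} (hη0 : 0 < η)
    (hη1 : η < 1) : qfin k m η ≤ qfin k n η := by
  have hm' : (0 : ℝ) < m := by exact_mod_cast hm
  have hmn' : (m : ℝ) ≤ n := by exact_mod_cast hmn
  have h1 : η / n ≤ η / m := by gcongr
  have h2 : 0 ≤ η / n := by positivity
  have := Real.rpow_le_rpow (x := 1 - η + η / n) (y := 1 - η + η / m) (z := (1 : ℝ) / k)
    (by linarith) (by linarith) (by positivity)
  rw [qfin, qfin]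
  linarith

lemma qlim_pos {k : ℕ} (hk : 1 ≤ k) {η : ℝ} (hη0 : 0 < η) (hη1 : η < 1) : 0 < qlim k η := by
  have hk' : (0 : ℝ) < k := by exact_mod_cast hk
  have := Real.rpow_lt_one (x := 1 - η) (z := (1 : ℝ) / k) (by linarith) (by linarith)
    (by positivity)
  rw [qlim]
  linarith

lemma qlim_lt_half (k : ℕ) {η : ℝ} (hη1 : η < 1) : qlim k η < 1 / 2 := by
  have := Real.rpow_pos_of_pos (x := 1 - η) (by linarith) ((1 : ℝ) / k)
  rw [qlim]
  linarith

lemma qlim_sub_qfin_mul_le {k n : ℕ} (hk : 1 ≤ k) (hn : 1 ≤ n) {η : ℝ} (hη0 : 0 < η)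
    (hη1 : η < 1) : (qlim k η - qfin k n η) * n ≤ η / (1 - η) := by
  have hk' : (1 : ℝ) ≤ k := by exact_mod_cast hk
  have hn' : (0 : ℝ) < n := by exact_mod_cast hn
  have h1 : 0 < 1 - η := by linarith
  set a : ℝ := (1 : ℝ) / k with ha
  have ha0 : 0 ≤ a := by positivity
  have ha1 : a ≤ 1 := by rw [ha, div_le_one (by linarith)]; exact hk'
  set δ : ℝ := η / (1 - η) / n with hδ
  have hδ0 : 0 ≤ δ := by positivity
  have hfac : 1 - η + η / n = (1 - η) * (1 + δ) := by rw [hδ]; field_simp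
  have hb := rpow_one_add_le_one_add_mul_self (s := δ) (by linarith) ha0 ha1
  have hle : (1 - η) ^ a ≤ 1 := Real.rpow_le_one h1.le (by linarith) ha0
  have hp : 0 < (1 - η) ^ a := Real.rpow_pos_of_pos h1 a
  have hdiff : qlim k η - qfin k n η ≤ δ := by
    rw [qlim, qfin, hfac, Real.mul_rpow h1.le (by linarith)]
    have haδ : a * δ ≤ δ := mul_le_of_le_one_left hδ0 ha1
    nlinarith [mul_le_mul_of_nonneg_left hb hp.le, mul_nonneg ha0 hδ0]
  calc (qlim k η - qfin k n η) * n ≤ δ * n := by gcongr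
    _ = η / (1 - η) := by rw [hδ]; field_simp

end FlipRate

/-- Gibbs' inequality for two-point distributions. -/
lemma cross_entropy_le {p q : ℝ} (hp0 : 0 < p) (hp1 : p < 1) (hq0 : 0 < q) (hq1 : q < 1) :
    p * Real.log q + (1 - p) * Real.log (1 - q) ≤
      p * Real.log p + (1 - p) * Real.log (1 - p) := by
  have key : ∀ a b : ℝ, 0 < a → 0 < b → a * Real.log b ≤ a * Real.log a + (b - a) := by
    intro a b ha hb
    have h := Real.log_le_sub_one_of_pos (div_pos hb ha)
    rw [Real.log_div hb.ne' ha.ne'] at h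
    have h' := mul_le_mul_of_nonneg_left h ha.le
    have e : a * (b / a - 1) = b - a := by field_simp
    linarith
  linarith [key p q hp0 hq0, key (1 - p) (1 - q) (by linarith) (by linarith)]

lemma log_two_mul_binEnt (p : ℝ) : Real.log 2 * binEnt p =
    -(p * Real.log p + (1 - p) * Real.log (1 - p)) := by
  have : Real.log 2 ≠ 0 := (Real.log_pos one_lt_two).ne'
  rw [binEnt, Real.logb, Real.logb]
  field_simp
  ring

lemma bernoulliWeight_mul_two_rpow_le_one {n : ℕ} {p q d K L C : ℝ} (hp0 : 0 < p) (hp1 : p < 1)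
    (hq0 : 0 < q) (hq1 : q < 1 / 2) (hK : (p - q) * n ≤ K) (hL : -Real.log q ≤ L)
    (hdK : 0 ≤ d + K) (hC : (d + K) * L ≤ Real.log 2 * C) {t : Fin n → Bool}
    (ht : |(wt t : ℝ) - q * n| ≤ d) :
    bernoulliWeight q t * (2 : ℝ) ^ (binEnt p * n - C) ≤ 1 := by
  rw [bernoulliWeight_eq_exp hq0 (by linarith), Real.rpow_def_of_pos two_pos, ← Real.exp_add,
    Real.exp_le_one_iff, mul_sub, ← mul_assoc, log_two_mul_binEnt]
  have hg := cross_entropy_le hp0 hp1 hq0 (by linarith)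
  have hg' := mul_le_mul_of_nonneg_right hg (Nat.cast_nonneg (α := ℝ) n)
  have hlog : Real.log q ≤ Real.log (1 - q) := Real.log_le_log hq0 (by linarith)
  have hlog1 : Real.log (1 - q) ≤ 0 := Real.log_nonpos (by linarith) (by linarith)
  have hdev : p * n - wt t ≤ d + K := by linarith [(abs_le.mp ht).1]
  have h1 : (p * n - wt t) * (Real.log (1 - q) - Real.log q) ≤
      (d + K) * (Real.log (1 - q) - Real.log q) :=
    mul_le_mul_of_nonneg_right hdev (by linarith)
  have h2 : (d + K) * (Real.log (1 - q) - Real.log q) ≤ (d + K) * L :=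
    mul_le_mul_of_nonneg_left (by linarith) hdK
  linarith

lemma four_mul_exp_neg_mul_cube_le_one {r : ℝ} (hr : 24576 ≤ r) :
    4 * Real.exp (-(r / 4)) * r ^ 3 ≤ 1 := by
  have h := Real.pow_div_factorial_le_exp (r / 4) (by linarith) 4
  rw [Real.exp_neg, mul_assoc, mul_comm _ (r ^ 3), ← mul_assoc, ← div_eq_mul_inv,
    div_le_one (Real.exp_pos _)]
  refine le_trans ?_ h
  norm_num [Nat.factorial]
  nlinarith [pow_pos (show (0 : ℝ) < r by linarith) 3]

lemma card_succSetNS {n k : ℕ} (η : ℝ) (F : Finset (Finset (Fin n)))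
    (c : Finset (Fin n) → ℝ) (x : Fin n → Bool) :
    (succSetNS k η F c x).card = ((shell k n η).filter fun t =>
      objH F c (fun i => xor (x i) (t i)) ≤ (1 - η) * objH F c x).card := by
  refine Finset.card_image_of_injective _ fun s t hst => funext fun i => ?_
  simpa using congrFun hst i


/-- **Lower bound on the successful set in the correlated-pair regime** (Lemma 5.2): for
fixed `k ≥ 1` and `η ∈ (0,1)`, there are `C > 0` and `n₀` (depending only on `k` and `η`)
such that for all `n ≥ n₀`, every homogeneous degree-`k` objective `H ≢ 0` on `{-1,1}^n`
and every optimum assignment `x*` of `H`, the successful set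
`S_η^{ns} = {x*⊙t : t ∈ A_η, H(x*⊙t) ≤ (1-η)·H_min}` satisfies
`|S_η^{ns}| ≥ (1/(2n))·2^{h(q_η)·n - C·n^{2/3}}`. -/
theorem successful_set_lower_bound_ns (k : ℕ) (hk : 1 ≤ k) (η : ℝ)
    (hη0 : 0 < η) (hη1 : η < 1) :
    ∃ C : ℝ, 0 < C ∧ ∃ n₀ : ℕ, ∀ n : ℕ, n₀ ≤ n →
      ∀ (F : Finset (Finset (Fin n))) (c : Finset (Fin n) → ℝ),
        (∀ S ∈ F, S.card = k) →
        (∃ x, objH F c x ≠ 0) →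
        ∀ xstar : Fin n → Bool, (∀ y, objH F c xstar ≤ objH F c y) →
          (1 / (2 * (n : ℝ))) *
              (2 : ℝ) ^ (binEnt (qlim k η) * n - C * (n : ℝ) ^ ((2 : ℝ) / 3))
            ≤ ((succSetNS k η F c xstar).card : ℝ) := by
  have h1η : 0 < 1 - η := by linarith
  have hlog2 : 0 < Real.log 2 := Real.log_pos one_lt_two
  set K : ℝ := η / (1 - η) with hKdef
  have hK0 : 0 < K := div_pos hη0 h1η
  set L : ℝ := -Real.log (qfin k 2 η) with hLdef
  have hq2 := qfin_pos hk le_rfl hη0 hη1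
  have hL0 : 0 < L := by
    have := Real.log_neg hq2 (by linarith [qfin_lt_half k 2 hη0 hη1])
    linarith
  refine ⟨(1 + K) * L / Real.log 2, by positivity, 24576 ^ 3, ?_⟩
  intro n hn F c hF hne x hx
  have hn2 : 2 ≤ n := le_trans (by norm_num) hn
  have hn0 : (0 : ℝ) < n := by exact_mod_cast (by lia : 0 < n)
  set q := qfin k n η with hq
  have hq0 : 0 < q := qfin_pos hk hn2 hη0 hη1
  have hqh : q < 1 / 2 := qfin_lt_half k n hη0 hη1
  obtain ⟨r, hr, hrn, hrd⟩ : ∃ r : ℝ, 24576 ≤ r ∧ r ^ 3 = n ∧ (n : ℝ) ^ ((2 : ℝ) / 3) = r ^ 2 := by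
    refine ⟨(n : ℝ) ^ ((1 : ℝ) / 3), ?_, ?_, ?_⟩
    · have h : ((24576 : ℝ) ^ 3) ^ ((1 : ℝ) / 3) ≤ (n : ℝ) ^ ((1 : ℝ) / 3) :=
        Real.rpow_le_rpow (by positivity) (by exact_mod_cast hn) (by norm_num)
      rwa [← Real.rpow_natCast, ← Real.rpow_mul (by norm_num),
        show ((3 : ℕ) : ℝ) * (1 / 3) = 1 by norm_num, Real.rpow_one] at h
    · rw [← Real.rpow_natCast, ← Real.rpow_mul hn0.le]
      norm_num
    · rw [← Real.rpow_natCast, ← Real.rpow_mul hn0.le]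
      norm_num
  have hr0 : 0 < r := by linarith
  have hgood := le_sum_bernoulliWeight_good hq0.le (by linarith) hη0
    (one_sub_two_mul_qfin_pow hk n hη0 hη1) hF hx (objH_min_neg hk hF hne hx)
  have htail := sum_bernoulliWeight_tail_le (n := n) (q := q) (s := 1 / (2 * r)) (d := r ^ 2)
    hq0.le (by linarith) (by positivity) (by rw [div_le_one (by positivity)]; linarith)
  have htail' : ∑ t : Fin n → Bool with ¬ |(wt t : ℝ) - q * n| ≤ r ^ 2, bernoulliWeight q t ≤
      1 / (2 * n) := by
    refine htail.trans ?_
    have he : (1 / (2 * r)) ^ 2 * n - 1 / (2 * r) * r ^ 2 = -(r / 4) := by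
      rw [← hrn]
      field_simp
      ring
    rw [he, le_div_iff₀ (by positivity), ← hrn]
    linarith [four_mul_exp_neg_mul_cube_le_one hr]
  rw [card_succSetNS]
  set G := (Finset.univ.filter fun t : Fin n → Bool =>
    objH F c (fun i => xor (x i) (t i)) ≤ (1 - η) * objH F c x) with hG
  set T := (shell k n η).filter fun t =>
    objH F c (fun i => xor (x i) (t i)) ≤ (1 - η) * objH F c x with hT
  set B := (Finset.univ.filter fun t : Fin n → Bool => ¬ |(wt t : ℝ) - q * n| ≤ r ^ 2) with hB
  have hw : ∀ t : Fin n → Bool, 0 ≤ bernoulliWeight q t :=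
    bernoulliWeight_nonneg hq0.le (by linarith)
  have hsub : G ⊆ T ∪ B := by
    intro t ht
    simp only [hG, hT, hB, shell, Finset.mem_union, Finset.mem_filter, Finset.mem_univ, true_and,
      hrd] at ht ⊢
    tauto
  have hsum : ∑ t ∈ G, bernoulliWeight q t ≤
      ∑ t ∈ T, bernoulliWeight q t + ∑ t ∈ B, bernoulliWeight q t := by
    refine (Finset.sum_le_sum_of_subset_of_nonneg hsub fun t _ _ => hw t).trans ?_
    rw [← Finset.sum_union_inter]
    exact le_add_of_nonneg_right (Finset.sum_nonneg fun t _ => hw t)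
  have hhalf : 1 / (2 * (n : ℝ)) ≤ ∑ t ∈ T, bernoulliWeight q t := by
    have : 1 / (n : ℝ) = 1 / (2 * n) + 1 / (2 * n) := by field_simp; norm_num
    linarith
  rw [hrd]
  have hC : (r ^ 2 + K) * L ≤ Real.log 2 * ((1 + K) * L / Real.log 2 * r ^ 2) := by
    have e : Real.log 2 * ((1 + K) * L / Real.log 2 * r ^ 2) = (r ^ 2 + K * r ^ 2) * L := by
      field_simp
    rw [e]
    refine mul_le_mul_of_nonneg_right ?_ hL0.le
    have : 1 ≤ r ^ 2 := one_le_pow₀ (by linarith)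
    nlinarith
  have hL : -Real.log q ≤ L :=
    neg_le_neg (Real.log_le_log hq2 (qfin_mono k (by norm_num) hn2 hη0 hη1))
  calc _ ≤ (∑ t ∈ T, bernoulliWeight q t) *
        (2 : ℝ) ^ (binEnt (qlim k η) * n - (1 + K) * L / Real.log 2 * r ^ 2) := by gcongr
    _ = ∑ t ∈ T, bernoulliWeight q t *
        (2 : ℝ) ^ (binEnt (qlim k η) * n - (1 + K) * L / Real.log 2 * r ^ 2) :=
      Finset.sum_mul ..
    _ ≤ ∑ t ∈ T, (1 : ℝ) := by
      refine Finset.sum_le_sum fun t ht => ?_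
      have ht' : |(wt t : ℝ) - q * n| ≤ r ^ 2 := by
        simp only [hT, shell, Finset.mem_filter, hrd] at ht
        exact ht.1.2
      exact bernoulliWeight_mul_two_rpow_le_one (qlim_pos hk hη0 hη1)
        (by linarith [qlim_lt_half k hη1]) hq0 hqh
        (qlim_sub_qfin_mul_le hk (by lia) hη0 hη1) hL (by positivity) hC ht'
    _ = (T.card : ℝ) := by simp
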